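/- In the even Wronskian setup with n = 2k, suppose det W^{(0)}, det DW^{(1)}, det(W^{(0)} − W^{(1)}(DW^{(1)})⁻¹DW^{(0)}) and det(DW^{(1)} − (DW^{(0)})(W^{(0)})⁻¹W^{(1)}) are invertible even superfields. Let DW̄^{(i)} denote the k×k matrix whose first k−1 rows are Dθ^{(i)}, D∂θ^{(i)}, …, D∂^{k−2}θ^{(i)} and whose last row is ∂^k θ^{(i)}. Then D((sdet 𝒲)⁻¹) = det(DW̄^{(1)} − (DW̄^{(0)})(W^{(0)})⁻¹W^{(1)}) · (det W^{(0)})⁻¹, where the determinant in the numerator is of a matrix all of whose rows consist of even superfields except the last, which consists of odd superfields, and is defined by Laplace expansion along that last row (the complementary minors have even, hence commuting, entries, so this is well defined). -/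

import Mathlib

noncomputable section
open scoped BigOperators

/-- The exterior algebra `Λ` of `ℝ^N`. -/
abbrev SuperAlg (N : ℕ) : Type := ExteriorAlgebra ℝ (Fin N → ℝ)

/-- The even part `Λ₀` of the exterior algebra. -/
def LambdaEven (N : ℕ) : Submodule ℝ (SuperAlg N) :=
  CliffordAlgebra.evenOdd (0 : QuadraticForm ℝ (Fin N → ℝ)) 0

/-- The odd part `Λ₁` of the exterior algebra. -/
def LambdaOdd (N : ℕ) : Submodule ℝ (SuperAlg N) :=
  CliffordAlgebra.evenOdd (0 : QuadraticForm ℝ (Fin N → ℝ)) 1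

/-- A superfield: a pair `(f₀, f₁)` of maps `ℝ² → Λ`, encoding
`f(x,t,ϑ) = f₀(x,t) + ϑ f₁(x,t)`. -/
@[ext] structure SF (N : ℕ) where
  c0 : ℝ → ℝ → SuperAlg N
  c1 : ℝ → ℝ → SuperAlg N

namespace SF
variable {N : ℕ}

instance : Zero (SF N) := ⟨⟨0, 0⟩⟩
instance : Add (SF N) := ⟨fun f g => ⟨f.c0 + g.c0, f.c1 + g.c1⟩⟩
instance : Neg (SF N) := ⟨fun f => ⟨-f.c0, -f.c1⟩⟩
instance : Sub (SF N) := ⟨fun f g => ⟨f.c0 - g.c0, f.c1 - g.c1⟩⟩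
instance : SMul ℕ (SF N) := ⟨fun n f => ⟨n • f.c0, n • f.c1⟩⟩
instance : SMul ℤ (SF N) := ⟨fun n f => ⟨n • f.c0, n • f.c1⟩⟩
instance : SMul ℝ (SF N) := ⟨fun r f => ⟨r • f.c0, r • f.c1⟩⟩

instance : AddCommGroup (SF N) :=
  Function.Injective.addCommGroup
    (M₂ := (ℝ → ℝ → SuperAlg N) × (ℝ → ℝ → SuperAlg N))
    (fun f => (f.c0, f.c1))
    (fun a b h => by cases a; cases b; simpa using h)
    rfl (fun _ _ => rfl) (fun _ => rfl) (fun _ _ => rfl) (fun _ _ => rfl) (fun _ _ => rfl)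

instance : One (SF N) := ⟨⟨fun _ _ => 1, fun _ _ => 0⟩⟩

/-- The product of superfields: `(fg)₀ = f₀g₀`,
`(fg)₁ = f₁g₀ + σ(f₀)g₁` where `σ` is the grade involution of `Λ`
(this is the bilinear extension of the parity-sign formula for homogeneous factors). -/
instance : Mul (SF N) := ⟨fun f g =>
  ⟨fun x t => f.c0 x t * g.c0 x t,
   fun x t => f.c1 x t * g.c0 x t + CliffordAlgebra.involute (f.c0 x t) * g.c1 x t⟩⟩

/-- An even superfield. -/
def IsEven (f : SF N) : Prop :=
  (∀ x t, f.c0 x t ∈ LambdaEven N) ∧ (∀ x t, f.c1 x t ∈ LambdaOdd N)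

/-- An odd superfield. -/
def IsOdd (f : SF N) : Prop :=
  (∀ x t, f.c0 x t ∈ LambdaOdd N) ∧ (∀ x t, f.c1 x t ∈ LambdaEven N)

/-- A superfield is invertible when `f₀(x,t)` is invertible in `Λ` for all `(x,t)`. -/
def Invertible (f : SF N) : Prop := ∀ x t, IsUnit (f.c0 x t)

/-- The multiplicative inverse of a superfield (junk unless `f` is invertible). -/
def sinv (f : SF N) : SF N :=
  ⟨fun x t => Ring.inverse (f.c0 x t),
   fun x t => -(Ring.inverse (CliffordAlgebra.involute (f.c0 x t)) * f.c1 x t *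
      Ring.inverse (f.c0 x t))⟩

end SF

/-- Derivative of a `Λ`-valued function of one real variable, characterized through all
linear functionals (junk value `0` when not differentiable). -/
def derLam {N : ℕ} (g : ℝ → SuperAlg N) (x : ℝ) : SuperAlg N := by
  classical
  exact if h : ∃ d : SuperAlg N, ∀ l : SuperAlg N →ₗ[ℝ] ℝ,
      HasDerivAt (fun y => l (g y)) (l d) x
    then h.choose else 0

/-- Smoothness of a `Λ`-valued function on `ℝ²`. -/
def SmoothLam {N : ℕ} (g : ℝ → ℝ → SuperAlg N) : Prop :=
  ∀ l : SuperAlg N →ₗ[ℝ] ℝ, ContDiff ℝ (⊤ : ℕ∞) (fun p : ℝ × ℝ => l (g p.1 p.2))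

namespace SF
variable {N : ℕ}

/-- A superfield is smooth when both components are. -/
def Smooth (f : SF N) : Prop := SmoothLam f.c0 ∧ SmoothLam f.c1

/-- `∂f`, the `x`-derivative. -/
def dx (f : SF N) : SF N :=
  ⟨fun x t => derLam (fun y => f.c0 y t) x, fun x t => derLam (fun y => f.c1 y t) x⟩

/-- `∂ₜf`, the `t`-derivative. -/
def dt (f : SF N) : SF N :=
  ⟨fun x t => derLam (fun s => f.c0 x s) t, fun x t => derLam (fun s => f.c1 x s) t⟩

/-- The odd superderivative `D`, with `Df = (f₁, ∂ₓf₀)`, so `D ∘ D = ∂`. -/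
def Dsd (f : SF N) : SF N := ⟨f.c1, fun x t => derLam (fun y => f.c0 y t) x⟩

end SF

/-- `D^n`. -/
def Dpow {N : ℕ} : ℕ → SF N → SF N
  | 0, f => f
  | m + 1, f => (Dpow m f).Dsd

/-- `∂^n`. -/
def Xpow {N : ℕ} : ℕ → SF N → SF N
  | 0, f => f
  | m + 1, f => (Xpow m f).dx

/-- `f` has the parity `(−1)^m`. -/
def parityAt {N : ℕ} (f : SF N) (m : ℕ) : Prop :=
  if m % 2 = 0 then f.IsEven else f.IsOdd

/-- The Manin–Radul supersymmetric KdV system. -/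
def MRSKdV {N : ℕ} (α u : SF N) : Prop :=
  α.dt = (1/4 : ℝ) • (α.dx.dx + (3:ℝ) • (α * α.Dsd) + (6:ℝ) • (α * u)).dx ∧
  u.dt = (1/4 : ℝ) • (u.dx.dx + (3:ℝ) • (u * u) + (3:ℝ) • (α * u.Dsd)).dx

/-- The Lax operator `L = ∂² + αD + u`. -/
def Lop {N : ℕ} (α u ψ : SF N) : SF N := ψ.dx.dx + α * ψ.Dsd + u * ψ

/-- The operator `M = (1/2)α∂D + λ∂ + (1/2)u∂ − (1/4)(∂α)D − (1/4)(∂u)`. -/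
def Mop {N : ℕ} (α u : SF N) (lam : ℝ) (ψ : SF N) : SF N :=
  (1/2 : ℝ) • (α * ψ.Dsd.dx) + lam • ψ.dx + (1/2 : ℝ) • (u * ψ.dx)
    - (1/4 : ℝ) • (α.dx * ψ.Dsd) - (1/4 : ℝ) • (u.dx * ψ)

/-- The linear system `Lψ = λψ`, `∂ₜψ = Mψ` associated with `(α,u)` at `λ`. -/
def LinSys {N : ℕ} (α u : SF N) (lam : ℝ) (ψ : SF N) : Prop :=
  Lop α u ψ = lam • ψ ∧ ψ.dt = Mop α u lam ψ

/-- `δ₀ = −(Dθ₀)θ₀⁻¹`. -/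
def delta0 {N : ℕ} (θ : SF N) : SF N := -(θ.Dsd * θ.sinv)

/-- The Darboux-transformed `α̂ = −α − 2∂δ₀`. -/
def hatAlpha {N : ℕ} (α θ : SF N) : SF N := -α - (2:ℝ) • (delta0 θ).dx

/-- The Darboux-transformed `û = u + Dα + 2δ₀(α + ∂δ₀)`. -/
def hatU {N : ℕ} (α u θ : SF N) : SF N :=
  u + α.Dsd + (2:ℝ) • (delta0 θ * (α + (delta0 θ).dx))

/-- `darbIter θ m j = θ_j[m]`, the `j`-th seed after `m` Darboux steps. -/
def darbIter {N : ℕ} (θ : ℕ → SF N) : ℕ → ℕ → SF N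
  | 0, j => θ j
  | m + 1, j => (darbIter θ m j).Dsd + delta0 (darbIter θ m m) * darbIter θ m j

/-- `Titer θ n ψ = T_n ψ = (D+δ_{n−1})⋯(D+δ₀)ψ`. -/
def Titer {N : ℕ} (θ : ℕ → SF N) : ℕ → SF N → SF N
  | 0, ψ => ψ
  | m + 1, ψ => (Titer θ m ψ).Dsd + delta0 (darbIter θ m m) * Titer θ m ψ

/-- Determinant of a matrix of superfields: Leibniz formula with rows in
ascending order (for matrices of commuting, e.g. even, entries this is the usual
determinant, and when exactly one row is odd it agrees with the Laplace
expansion along that row). -/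
def detSF {N k : ℕ} (M : Matrix (Fin k) (Fin k) (SF N)) : SF N :=
  ∑ σ : Equiv.Perm (Fin k),
    ((Equiv.Perm.sign σ : ℤ)) • (((List.finRange k).map fun i => M i (σ i)).prod)

/-- Entrywise `D`-derivative of a matrix of superfields. -/
def DmatSF {N m n : ℕ} (M : Matrix (Fin m) (Fin n) (SF N)) : Matrix (Fin m) (Fin n) (SF N) :=
  Matrix.of fun i j => (M i j).Dsd

/-- The embedding `Fin (k−1) → Fin k` skipping `j`. -/
def dropIdx {k : ℕ} (j : Fin k) (i : Fin (k - 1)) : Fin k :=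
  ⟨if i.1 < j.1 then i.1 else i.1 + 1, by
    have h1 := i.2; have h2 := j.2; split <;> omega⟩

/-- The minor of `M` obtained by deleting row `j` and column `i`. -/
def minorSF {N k : ℕ} (M : Matrix (Fin k) (Fin k) (SF N)) (j i : Fin k) :
    Matrix (Fin (k-1)) (Fin (k-1)) (SF N) :=
  M.submatrix (dropIdx j) (dropIdx i)

/-- Adjugate matrix (matrix of cofactors, transposed). -/
def adjSF {N k : ℕ} (M : Matrix (Fin k) (Fin k) (SF N)) : Matrix (Fin k) (Fin k) (SF N) :=
  Matrix.of fun i j => ((-1 : ℤ) ^ (i.1 + j.1)) • detSF (minorSF M j i)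

/-- Inverse of a matrix of (even) superfields, via the adjugate
(junk unless `detSF M` is invertible). -/
def invSF {N k : ℕ} (M : Matrix (Fin k) (Fin k) (SF N)) : Matrix (Fin k) (Fin k) (SF N) :=
  Matrix.of fun i j => (detSF M).sinv * adjSF M i j

section EvenWronskian

variable {N : ℕ}

/-- `θ^{(0)} = (θ₀, θ₂, …)`. -/
def evenSeq (θ : ℕ → SF N) : ℕ → SF N := fun j => θ (2 * j)

/-- `θ^{(1)} = (θ₁, θ₃, …)`. -/
def oddSeq (θ : ℕ → SF N) : ℕ → SF N := fun j => θ (2 * j + 1)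

/-- The `k×k` Wronski matrix with rows `v, ∂v, …, ∂^{k−1}v`. -/
def Wmat (N : ℕ) (k : ℕ) (v : ℕ → SF N) : Matrix (Fin k) (Fin k) (SF N) :=
  Matrix.of fun i j => Xpow i.1 (v j.1)

/-- The Wronski matrix with last row replaced by `∂^k v`. -/
def WmatHat (N : ℕ) (k : ℕ) (v : ℕ → SF N) : Matrix (Fin k) (Fin k) (SF N) :=
  Matrix.of fun i j => if i.1 = k - 1 then Xpow k (v j.1) else Xpow i.1 (v j.1)

/-- The Wronski matrix with rows `Dv, D∂v, …, D∂^{k−2}v` and last row `∂^k v`. -/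
def WmatBarD (N : ℕ) (k : ℕ) (v : ℕ → SF N) : Matrix (Fin k) (Fin k) (SF N) :=
  Matrix.of fun i j => if i.1 = k - 1 then Xpow k (v j.1) else (Xpow i.1 (v j.1)).Dsd

/-- `W^{(0)}` (even case, `n = 2k`). -/
def W0E (N k : ℕ) (θ : ℕ → SF N) : Matrix (Fin k) (Fin k) (SF N) := Wmat N k (evenSeq θ)

/-- `W^{(1)}` (even case, `n = 2k`). -/
def W1E (N k : ℕ) (θ : ℕ → SF N) : Matrix (Fin k) (Fin k) (SF N) := Wmat N k (oddSeq θ)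

/-- The Schur complement `W^{(0)} − W^{(1)}(DW^{(1)})⁻¹DW^{(0)}`. -/
def SchurE (N k : ℕ) (θ : ℕ → SF N) : Matrix (Fin k) (Fin k) (SF N) :=
  W0E N k θ - W1E N k θ * invSF (DmatSF (W1E N k θ)) * DmatSF (W0E N k θ)

/-- The Schur complement `DW^{(1)} − (DW^{(0)})(W^{(0)})⁻¹W^{(1)}`. -/
def SchurE2 (N k : ℕ) (θ : ℕ → SF N) : Matrix (Fin k) (Fin k) (SF N) :=
  DmatSF (W1E N k θ) - DmatSF (W0E N k θ) * invSF (W0E N k θ) * W1E N k θ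

/-- `sdet 𝒲` (even case). -/
def sdetE (N k : ℕ) (θ : ℕ → SF N) : SF N :=
  detSF (SchurE N k θ) * (detSF (DmatSF (W1E N k θ))).sinv

/-- The Schur complement of the block matrix `𝒲̂` (even case). -/
def SchurEHat (N k : ℕ) (θ : ℕ → SF N) : Matrix (Fin k) (Fin k) (SF N) :=
  WmatHat N k (evenSeq θ) - WmatHat N k (oddSeq θ) * invSF (DmatSF (W1E N k θ)) * DmatSF (W0E N k θ)

/-- `sdet 𝒲̂` (even case). -/
def sdetEHat (N k : ℕ) (θ : ℕ → SF N) : SF N :=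
  detSF (SchurEHat N k θ) * (detSF (DmatSF (W1E N k θ))).sinv

end EvenWronskian

section OddWronskian

/-- `W^{(0)}`, a `(k+1)×(k+1)` matrix (odd case, `n = 2k+1`). -/
def W0O (N k : ℕ) (θ : ℕ → SF N) : Matrix (Fin (k+1)) (Fin (k+1)) (SF N) :=
  Matrix.of fun i j => Xpow i.1 (θ (2 * j.1))

/-- `W^{(1)}`, a `(k+1)×k` matrix (odd case). -/
def W1O (N k : ℕ) (θ : ℕ → SF N) : Matrix (Fin (k+1)) (Fin k) (SF N) :=
  Matrix.of fun i j => Xpow i.1 (θ (2 * j.1 + 1))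

/-- `W̃^{(0)}`: `W^{(0)}` with its last row removed. -/
def Wtil0 (N k : ℕ) (θ : ℕ → SF N) : Matrix (Fin k) (Fin (k+1)) (SF N) :=
  Matrix.of fun i j => Xpow i.1 (θ (2 * j.1))

/-- `W̃^{(1)}`: `W^{(1)}` with its last row removed. -/
def Wtil1 (N k : ℕ) (θ : ℕ → SF N) : Matrix (Fin k) (Fin k) (SF N) :=
  Matrix.of fun i j => Xpow i.1 (θ (2 * j.1 + 1))

/-- `W̌^{(0)}`: `W^{(0)}` with its second-to-last row removed. -/
def Wchk0 (N k : ℕ) (θ : ℕ → SF N) : Matrix (Fin k) (Fin (k+1)) (SF N) :=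
  Matrix.of fun i j => Xpow (if i.1 = k - 1 then k else i.1) (θ (2 * j.1))

/-- `W̌^{(1)}`: `W^{(1)}` with its second-to-last row removed. -/
def Wchk1 (N k : ℕ) (θ : ℕ → SF N) : Matrix (Fin k) (Fin k) (SF N) :=
  Matrix.of fun i j => Xpow (if i.1 = k - 1 then k else i.1) (θ (2 * j.1 + 1))

/-- `Ŵ^{(0)}`: `W^{(0)}` with last row `∂^k θ^{(0)}` replaced by `D∂^k θ^{(0)}`. -/
def W0OHat (N k : ℕ) (θ : ℕ → SF N) : Matrix (Fin (k+1)) (Fin (k+1)) (SF N) :=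
  Matrix.of fun i j => if i.1 = k then Dpow (2*k+1) (θ (2 * j.1)) else Xpow i.1 (θ (2 * j.1))

/-- `Ŵ^{(1)}`: `W^{(1)}` with last row `∂^k θ^{(1)}` replaced by `D∂^k θ^{(1)}`. -/
def W1OHat (N k : ℕ) (θ : ℕ → SF N) : Matrix (Fin (k+1)) (Fin k) (SF N) :=
  Matrix.of fun i j => if i.1 = k then Dpow (2*k+1) (θ (2 * j.1 + 1)) else Xpow i.1 (θ (2 * j.1 + 1))

/-- The Schur complement `W^{(0)} − W^{(1)}(DW̃^{(1)})⁻¹DW̃^{(0)}`. -/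
def SchurO (N k : ℕ) (θ : ℕ → SF N) : Matrix (Fin (k+1)) (Fin (k+1)) (SF N) :=
  W0O N k θ - W1O N k θ * invSF (DmatSF (Wtil1 N k θ)) * DmatSF (Wtil0 N k θ)

/-- The Schur complement `W^{(0)} − W^{(1)}(DW̌^{(1)})⁻¹DW̌^{(0)}`. -/
def SchurOchk (N k : ℕ) (θ : ℕ → SF N) : Matrix (Fin (k+1)) (Fin (k+1)) (SF N) :=
  W0O N k θ - W1O N k θ * invSF (DmatSF (Wchk1 N k θ)) * DmatSF (Wchk0 N k θ)

/-- The Schur complement `Ŵ^{(0)} − Ŵ^{(1)}(DW̃^{(1)})⁻¹DW̃^{(0)}`. -/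
def SchurOHat (N k : ℕ) (θ : ℕ → SF N) : Matrix (Fin (k+1)) (Fin (k+1)) (SF N) :=
  W0OHat N k θ - W1OHat N k θ * invSF (DmatSF (Wtil1 N k θ)) * DmatSF (Wtil0 N k θ)

/-- `sdet 𝒲` (odd case). -/
def sdetO (N k : ℕ) (θ : ℕ → SF N) : SF N :=
  detSF (SchurO N k θ) * (detSF (DmatSF (Wtil1 N k θ))).sinv

/-- `sdet 𝒲̌` (odd case). -/
def sdetOchk (N k : ℕ) (θ : ℕ → SF N) : SF N :=
  detSF (SchurOchk N k θ) * (detSF (DmatSF (Wchk1 N k θ))).sinv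

/-- The quotient `det(Ŵ^{(0)} − Ŵ^{(1)}(DW̃^{(1)})⁻¹DW̃^{(0)}) / det(W^{(0)} − W^{(1)}(DW̃^{(1)})⁻¹DW̃^{(0)})`. -/
def Qodd (N k : ℕ) (θ : ℕ → SF N) : SF N :=
  detSF (SchurOHat N k θ) * (detSF (SchurO N k θ)).sinv

end OddWronskian


structure SD (R : Type) [Ring R] where
  E : Subring R
  O : AddSubgroup R
  D : R → R
  comm : ∀ e ∈ E, ∀ r, e * r = r * e
  EO : ∀ e ∈ E, ∀ o ∈ O, e * o ∈ O
  OO : ∀ a ∈ O, ∀ b ∈ O, a * b ∈ E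
  anti : ∀ a ∈ O, ∀ b ∈ O, a * b = -(b * a)
  sq : ∀ a ∈ O, a * a = 0
  DE : ∀ e ∈ E, D e ∈ O
  DO : ∀ o ∈ O, D o ∈ E
  addE : ∀ a ∈ E, ∀ b ∈ E, D (a + b) = D a + D b
  addO : ∀ a ∈ O, ∀ b ∈ O, D (a + b) = D a + D b
  D_EE : ∀ a ∈ E, ∀ b ∈ E, D (a * b) = D a * b + a * D b
  D_EO : ∀ a ∈ E, ∀ b ∈ O, D (a * b) = D a * b + a * D b
  D_OO : ∀ a ∈ O, ∀ b ∈ O, D (a * b) = D a * b - a * D b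

namespace SD
variable {R : Type} [Ring R] (S : SD R)

instance instCR : CommRing S.E :=
  { (inferInstance : Ring S.E) with
    mul_comm := fun a b => Subtype.ext (S.comm a a.2 b) }

/-- matrices with even entries mapped to matrices over the whole ring -/
abbrev im {m : Type} [Fintype m] [DecidableEq m] : Matrix m m S.E →+* Matrix m m R :=
  RingHom.mapMatrix S.E.subtype

lemma im_inj {m : Type} [Fintype m] [DecidableEq m] {P Q : Matrix m m S.E}
    (h : S.im P = S.im Q) : P = Q := by
  ext i j
  exact congrFun (congrFun h i) j

lemma exists_lift {m : Type} [Fintype m] [DecidableEq m] (M : Matrix m m R)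
    (h : ∀ i j, M i j ∈ S.E) : ∃ P : Matrix m m S.E, S.im P = M :=
  ⟨fun i j => ⟨M i j, h i j⟩, by ext i j; rfl⟩

lemma OO_mat {m : Type} [Fintype m] {U V : Matrix m m R}
    (hU : ∀ i j, U i j ∈ S.O) (hV : ∀ i j, V i j ∈ S.O) (i j) : (U * V) i j ∈ S.E := by
  rw [Matrix.mul_apply]
  exact sum_mem fun l _ => S.OO _ (hU _ _) _ (hV _ _)

lemma EO_mat {m : Type} [Fintype m] [DecidableEq m] (P : Matrix m m S.E) {V : Matrix m m R}
    (hV : ∀ i j, V i j ∈ S.O) (i j) : (S.im P * V) i j ∈ S.O := by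
  rw [Matrix.mul_apply]
  exact sum_mem fun l _ => S.EO _ (P i l).2 _ (hV _ _)

lemma OE_mat {m : Type} [Fintype m] [DecidableEq m] (P : Matrix m m S.E) {V : Matrix m m R}
    (hV : ∀ i j, V i j ∈ S.O) (i j) : (V * S.im P) i j ∈ S.O := by
  rw [Matrix.mul_apply]
  refine sum_mem fun l _ => ?_
  rw [← S.comm _ (by exact (P l j).2)]
  exact S.EO _ (P l j).2 _ (hV _ _)

lemma ber_single {m : Type} [Fintype m] [DecidableEq m] (i j : m) (a : R) (ha : a ∈ S.O)
    (V : Matrix m m R) (hV : ∀ i j, V i j ∈ S.O) (P Q : Matrix m m S.E)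
    (hP : S.im P = Matrix.single i j a * V) (hQ : S.im Q = V * Matrix.single i j a) :
    (1 - P).det * (1 - Q).det = 1 := by
  have hPe : ∀ l n, ((P l n : S.E) : R) = if l = i then a * V j n else 0 := by
    intro l n
    have := congrFun (congrFun hP l) n
    rw [show ((P l n : S.E) : R) = S.im P l n from rfl, this]
    split_ifs with h
    · subst h; simp
    · simp [h]
  have hQe : ∀ l n, ((Q l n : S.E) : R) = if n = j then V l i * a else 0 := by
    intro l n
    have := congrFun (congrFun hQ l) n
    rw [show ((Q l n : S.E) : R) = S.im Q l n from rfl, this]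
    split_ifs with h
    · subst h; simp
    · simp [h]
  have dP : (1 - P).det = 1 - P i i := by
    have : P = Matrix.replicateCol Unit (Pi.single i (1 : S.E) : m → S.E) * Matrix.replicateRow Unit (P i) := by
      ext l n
      rw [hPe]
      by_cases h : l = i
      · subst h; simp [Matrix.mul_apply, hPe]
      · simp [Matrix.mul_apply, h]
    conv_lhs => rw [this]
    rw [Matrix.det_one_sub_mul_comm]
    simp [Matrix.mul_apply, Pi.single_apply]
  have dQ : (1 - Q).det = 1 - Q j j := by
    have : Q = Matrix.replicateCol Unit (fun l => Q l j) *
        Matrix.replicateRow Unit (Pi.single j (1 : S.E) : m → S.E) := by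
      ext l n
      rw [hQe]
      by_cases h : n = j
      · subst h; simp [Matrix.mul_apply, hQe]
      · simp [Matrix.mul_apply, h]
    conv_lhs => rw [this]
    rw [Matrix.det_one_sub_mul_comm]
    simp [Matrix.mul_apply, Pi.single_apply]
  rw [dP, dQ]
  apply Subtype.ext
  push_cast
  rw [hPe, hQe]
  simp only [if_true]
  have h1 : V j i * a = -(a * V j i) := S.anti _ (hV _ _) _ ha
  have h2 : (a * V j i) * (a * V j i) = 0 := by
    calc (a * V j i) * (a * V j i) = a * (V j i * a) * V j i := by noncomm_ring
      _ = -((a * a) * (V j i * V j i)) := by rw [h1]; noncomm_ring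
      _ = 0 := by rw [S.sq a ha]; simp
  rw [h1]
  calc (1 - a * V j i) * (1 - -(a * V j i)) = 1 - (a * V j i) * (a * V j i) := by noncomm_ring
    _ = 1 := by rw [h2]; simp

lemma ber_aux {m : Type} [Fintype m] [DecidableEq m] 
    (U V : Matrix m m R) (hU : ∀ i j, U i j ∈ S.O) (hV : ∀ i j, V i j ∈ S.O)
    (s : Finset (m × m)) : ∀ (P Q : Matrix m m S.E)
    (_ : S.im P = (∑ p ∈ s, Matrix.single p.1 p.2 (U p.1 p.2)) * V)
    (_ : S.im Q = V * (∑ p ∈ s, Matrix.single p.1 p.2 (U p.1 p.2))),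
    (1 - P).det * (1 - Q).det = 1 := by
  induction s using Finset.induction_on with
  | empty =>
    intro P Q hP hQ
    have h1 : P = 0 := S.im_inj (by rw [hP]; simp)
    have h2 : Q = 0 := S.im_inj (by rw [hQ]; simp)
    simp [h1, h2]
  | insert p s hp ih =>
    intro P Q hP hQ
    rw [Finset.sum_insert hp] at hP hQ
    set G : Matrix m m R := Matrix.single p.1 p.2 (U p.1 p.2) with hG
    set U' : Matrix m m R := ∑ p ∈ s, Matrix.single p.1 p.2 (U p.1 p.2) with hU'
    have sO : ∀ q : m × m, ∀ i j, (Matrix.single q.1 q.2 (U q.1 q.2)) i j ∈ S.O := by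
      intro q i j
      rw [Matrix.single_apply]
      split_ifs
      · exact hU _ _
      · exact zero_mem _
    have U'O : ∀ i j, U' i j ∈ S.O := by
      intro i j
      rw [hU', Matrix.sum_apply]
      exact sum_mem fun q _ => sO q i j
    obtain ⟨P1, hP1⟩ := S.exists_lift _ (S.OO_mat U'O hV)
    obtain ⟨Q1, hQ1⟩ := S.exists_lift _ (S.OO_mat hV U'O)
    obtain ⟨P2, hP2⟩ := S.exists_lift _ (S.OO_mat (sO p) hV)
    obtain ⟨Q2, hQ2⟩ := S.exists_lift _ (S.OO_mat hV (sO p))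
    have e1 : P = P2 + P1 := S.im_inj (by rw [hP, map_add, hP1, hP2, add_mul])
    have e2 : Q = Q2 + Q1 := S.im_inj (by rw [hQ, map_add, hQ1, hQ2, mul_add])
    have key := ih P1 Q1 hP1 hQ1
    have uP : IsUnit (1 - P1).det := .of_mul_eq_one _ key
    have uQ : IsUnit (1 - Q1).det := .of_mul_eq_one _ (by rw [mul_comm]; exact key)
    set J := (1 - P1)⁻¹ with hJ
    set K := (1 - Q1)⁻¹ with hK
    have J1 : J * (1 - P1) = 1 := Matrix.nonsing_inv_mul _ uP
    have J2 : (1 - P1) * J = 1 := Matrix.mul_nonsing_inv _ uP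
    have K1 : K * (1 - Q1) = 1 := Matrix.nonsing_inv_mul _ uQ
    have K2 : (1 - Q1) * K = 1 := Matrix.mul_nonsing_inv _ uQ
    have hVV : S.im (1 - Q1) * V = V * S.im (1 - P1) := by
      rw [map_sub, map_sub, map_one, hP1, hQ1, sub_mul, mul_sub, one_mul, mul_one, mul_assoc]
    have hVJ : V * S.im J = S.im K * V := by
      calc V * S.im J = S.im (K * (1 - Q1)) * V * S.im J := by rw [K1, map_one, one_mul]
        _ = S.im K * (S.im (1 - Q1) * V) * S.im J := by rw [map_mul]; noncomm_ring
        _ = S.im K * V * S.im ((1 - P1) * J) := by rw [hVV, map_mul]; simp only [mul_assoc]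
        _ = _ := by rw [J2, map_one, mul_one]
    have sing := S.ber_single p.1 p.2 (U p.1 p.2) (hU _ _) (V * S.im J) (S.OE_mat J hV)
      (P2 * J) (K * Q2) (by rw [map_mul, hP2, mul_assoc]) (by rw [map_mul, hQ2, hVJ, mul_assoc])
    have f1 : 1 - P = (1 - P2 * J) * (1 - P1) := by
      rw [e1, sub_mul, one_mul, mul_assoc, J1]; noncomm_ring
    have f2 : 1 - Q = (1 - Q1) * (1 - K * Q2) := by
      rw [e2, mul_sub, mul_one, ← mul_assoc, K2]; noncomm_ring
    rw [f1, f2, Matrix.det_mul, Matrix.det_mul]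
    calc _ = ((1 - P2 * J).det * (1 - K * Q2).det) * ((1 - P1).det * (1 - Q1).det) := by ring
      _ = 1 := by rw [sing, key, one_mul]

lemma ber {m : Type} [Fintype m] [DecidableEq m] 
    (U V : Matrix m m R) (hU : ∀ i j, U i j ∈ S.O) (hV : ∀ i j, V i j ∈ S.O)
    (P Q : Matrix m m S.E) (hP : S.im P = U * V) (hQ : S.im Q = V * U) :
    (1 - P).det * (1 - Q).det = 1 := by
  have : (∑ p : m × m, Matrix.single p.1 p.2 (U p.1 p.2)) = U := by
    rw [Fintype.sum_prod_type]
    exact (Matrix.matrix_eq_sum_single U).symm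
  exact S.ber_aux U V hU hV Finset.univ P Q (by rw [this, hP]) (by rw [this, hQ])

lemma D_zero : S.D 0 = 0 := by
  have := S.addE 0 (zero_mem _) 0 (zero_mem _)
  simpa using this

lemma D_sumE {ι : Type} (s : Finset ι) (f : ι → R) (hf : ∀ i, f i ∈ S.E) :
    S.D (∑ i ∈ s, f i) = ∑ i ∈ s, S.D (f i) := by
  classical
  induction s using Finset.induction_on with
  | empty => simp [S.D_zero]
  | insert a s ha ih =>
    rw [Finset.sum_insert ha, Finset.sum_insert ha, S.addE _ (hf a) _ (sum_mem fun i _ => hf i), ih]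

lemma D_sumO {ι : Type} (s : Finset ι) (f : ι → R) (hf : ∀ i, f i ∈ S.O) :
    S.D (∑ i ∈ s, f i) = ∑ i ∈ s, S.D (f i) := by
  classical
  induction s using Finset.induction_on with
  | empty => simp [S.D_zero]
  | insert a s ha ih =>
    rw [Finset.sum_insert ha, Finset.sum_insert ha, S.addO _ (hf a) _ (sum_mem fun i _ => hf i), ih]

lemma D_one : S.D 1 = 0 := by
  have := S.D_EE 1 (one_mem _) 1 (one_mem _)
  simpa using this

lemma D_negE (a : R) (ha : a ∈ S.E) : S.D (-a) = - S.D a := by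
  have := S.addE a ha (-a) (neg_mem ha)
  rw [add_neg_cancel, S.D_zero] at this
  exact (neg_eq_of_add_eq_zero_right this.symm).symm

lemma D_prod {ι : Type} [DecidableEq ι] (s : Finset ι) (f : ι → S.E) :
    S.D ((∏ i ∈ s, f i : S.E) : R) = ∑ i ∈ s, ((∏ l ∈ s.erase i, f l : S.E) : R) * S.D (f i) := by
  induction s using Finset.induction_on with
  | empty => simp [S.D_one]
  | insert a s ha ih =>
    rw [Finset.prod_insert ha, Finset.sum_insert ha, Finset.erase_insert ha]
    rw [Subring.coe_mul, S.D_EE _ (f a).2 _ (Subtype.prop _), ih, Finset.mul_sum,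
      S.comm _ (Subtype.prop (∏ i ∈ s, f i)) (S.D (f a))]
    congr 1
    refine Finset.sum_congr rfl fun i hi => ?_
    have : i ≠ a := by rintro rfl; exact ha hi
    rw [Finset.erase_insert_of_ne this.symm, Finset.prod_insert (by simp [ha]), Subring.coe_mul,
      mul_assoc]

lemma adj_sum {m : Type} [Fintype m] [DecidableEq m] (M : Matrix m m S.E) (i : m) (v : m → R) :
    ∑ j, ((M.adjugate j i : S.E) : R) * v j =
      ∑ σ : Equiv.Perm m, (Equiv.Perm.sign σ : ℤ) •
        (((∏ l ∈ Finset.univ.erase i, M l (σ l) : S.E) : R) * v (σ i)) := by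
  have : ∀ j, ((M.adjugate j i : S.E) : R) * v j = ∑ σ : Equiv.Perm m, (Equiv.Perm.sign σ : ℤ) •
        (((∏ l ∈ Finset.univ.erase i, M l (σ l) : S.E) : R) * (if σ i = j then v j else 0)) := by
    intro j
    rw [Matrix.adjugate_apply, ← Matrix.det_transpose, Matrix.det_apply]
    have hh : ∀ σ : Equiv.Perm m, ∏ l, (M.updateRow i (Pi.single j 1)).transpose (σ l) l =
        (∏ l ∈ Finset.univ.erase i, M l (σ l)) * (if σ i = j then 1 else 0) := by
      intro σ
      rw [← Finset.prod_erase_mul _ _ (Finset.mem_univ i)]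
      congr 1
      · refine Finset.prod_congr rfl fun l hl => ?_
        simp [Matrix.updateRow_ne (Finset.ne_of_mem_erase hl)]
      · simp [Pi.single_apply]
    simp_rw [hh]
    rw [← Subring.subtype_apply, map_sum, Finset.sum_mul]
    refine Finset.sum_congr rfl fun σ _ => ?_
    rw [Units.smul_def, map_zsmul, smul_mul_assoc]
    congr 1
    split_ifs <;> simp
  simp_rw [this]
  rw [Finset.sum_comm]
  refine Finset.sum_congr rfl fun σ _ => ?_
  rw [← Finset.smul_sum, ← Finset.mul_sum]
  simp

lemma D_det {m : Type} [Fintype m] [DecidableEq m] (M : Matrix m m S.E) :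
    S.D (M.det : R) = ∑ i, ∑ j, ((M.adjugate j i : S.E) : R) * S.D (M i j) := by
  simp_rw [fun i => S.adj_sum M i (fun j => S.D (M i j))]
  rw [Finset.sum_comm, ← Matrix.det_transpose, Matrix.det_apply, ← Subring.subtype_apply, map_sum,
    S.D_sumE _ _ (by intro i; exact SetLike.coe_mem (Equiv.Perm.sign i • ∏ l, M.transpose (i l) l))]
  refine Finset.sum_congr rfl fun σ _ => ?_
  rw [← Finset.smul_sum]
  simp only [Matrix.transpose_apply]
  rw [← S.D_prod Finset.univ (fun i => M i (σ i))]
  rcases Int.units_eq_one_or (Equiv.Perm.sign σ) with h | h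
  · simp [h]
  · rw [h]
    simp only [Units.smul_def, Units.val_neg, Units.val_one, neg_smul, one_smul, map_neg]
    rw [S.D_negE _ (by exact SetLike.coe_mem (∏ l, M l (σ l)))]
    rfl

/-- noncommutative determinant -/
def detR {k : ℕ} (M : Matrix (Fin k) (Fin k) R) : R :=
  ∑ σ : Equiv.Perm (Fin k),
    ((Equiv.Perm.sign σ : ℤ)) • (((List.finRange k).map fun i => M i (σ i)).prod)

lemma detR_im {k : ℕ} (M : Matrix (Fin k) (Fin k) S.E) : detR (S.im M) = M.det := by
  rw [detR, ← Matrix.det_transpose, Matrix.det_apply, ← Subring.subtype_apply, map_sum]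
  refine Finset.sum_congr rfl fun σ _ => ?_
  rw [Units.smul_def, map_zsmul]
  congr 1
  rw [Subring.subtype_apply, Fin.prod_univ_def, ← Subring.subtype_apply, map_list_prod, List.map_map]
  rfl

lemma detR_last {n : ℕ} (M : Matrix (Fin (n+1)) (Fin (n+1)) S.E) (N : Matrix (Fin (n+1)) (Fin (n+1)) R)
    (h : ∀ i j, i ≠ Fin.last n → N i j = M i j) :
    detR N = ∑ j, ((M.adjugate j (Fin.last n) : S.E) : R) * N (Fin.last n) j := by
  rw [S.adj_sum, detR]
  refine Finset.sum_congr rfl fun σ _ => ?_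
  congr 1
  rw [List.finRange_succ_last, List.map_append, List.prod_append]
  simp only [List.map_map, List.map_cons, List.map_nil, List.prod_cons, List.prod_nil, mul_one]
  congr 1
  have e : (Finset.univ : Finset (Fin (n+1))).erase (Fin.last n) = Finset.univ.map Fin.castSuccEmb := by
    ext i
    induction i using Fin.lastCases <;> simp
  rw [e, Finset.prod_map, Fin.prod_univ_def, ← Subring.subtype_apply, map_list_prod, List.map_map]
  congr 1
  refine List.map_congr_left fun i _ => ?_
  exact h _ _ (Fin.castSucc_lt_last i).ne


theorem main {n : ℕ} (W0 W0i A Ai S1 : Matrix (Fin (n+1)) (Fin (n+1)) S.E)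
    (W1 : Matrix (Fin (n+1)) (Fin (n+1)) R) (b0 b1 : Fin (n+1) → R)
    (h1 : ∀ i j, W1 i j ∈ S.O) 
    (hA : ∀ i j, (A i j : R) = S.D (W1 i j))
    (hW : W0 * W0i = 1) (hAi : A * Ai = 1)
    (hS1 : S.im S1 = S.im W0 - W1 * S.im Ai * Matrix.of fun i j => S.D (W0 i j))
    (r0 : ∀ (i : Fin n) j, S.D (S.D (W0 i.castSucc j)) = W0 i.succ j)
    (r1 : ∀ (i : Fin n) j, S.D (S.D (W1 i.castSucc j)) = W1 i.succ j)
    (l0 : ∀ j, S.D (S.D (W0 (Fin.last n) j)) = b0 j)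
    (l1 : ∀ j, S.D (S.D (W1 (Fin.last n) j)) = b1 j)
    (N : Matrix (Fin (n+1)) (Fin (n+1)) R)
    (hN : ∀ (i : Fin n) j, N i.castSucc j = 
      S.D (W1 i.castSucc j) - ∑ l, S.D (W0 i.castSucc l) * (S.im W0i * W1) l j)
    (hNl : ∀ j, N (Fin.last n) j = b1 j - ∑ l, b0 l * (S.im W0i * W1) l j) :
    ∃ t : S.E, S1.det * Ai.det * t = 1 ∧ S.D t = detR N * (W0i.det : R) := by
  have hW' : W0i * W0 = 1 := mul_eq_one_comm.mp hW
  have hAi' : Ai * A = 1 := mul_eq_one_comm.mp hAi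
  set X := S.im W0i * W1 with hX
  have hXO : ∀ i j, X i j ∈ S.O := S.EO_mat _ h1
  have hWX : S.im W0 * X = W1 := by
    rw [hX, ← mul_assoc, ← map_mul, hW, map_one, one_mul]
  have hWXe : ∀ i j, W1 i j = ∑ l, (W0 i l : R) * X l j := by
    intro i j
    conv_lhs => rw [← hWX, Matrix.mul_apply]
    rfl
  let T : Matrix (Fin (n+1)) (Fin (n+1)) S.E := fun i j => ⟨S.D (X i j), S.DO _ (hXO i j)⟩
  have hT : ∀ i j, ((T i j : S.E) : R) = S.D (X i j) := fun _ _ => rfl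
  set C : Matrix (Fin (n+1)) (Fin (n+1)) R := Matrix.of fun i j => S.D (W0 i j) with hC
  have hCO : ∀ i j, C i j ∈ S.O := fun i j => S.DE _ (W0 i j).2
  -- first derivative
  have d1 : ∀ i j, S.D (W1 i j) = ∑ l, (S.D (W0 i l) * X l j + (W0 i l : R) * S.D (X l j)) := by
    intro i j
    rw [hWXe, S.D_sumO _ _ (fun l => S.EO _ (W0 i l).2 _ (hXO _ _))]
    exact Finset.sum_congr rfl fun l _ => S.D_EO _ (W0 i l).2 _ (hXO _ _)
  have d2 : ∀ i j, S.D (S.D (W1 i j)) = ∑ l, S.D (S.D (W0 i l)) * X l j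
      + ∑ l, (W0 i l : R) * S.D (S.D (X l j)) := by
    intro i j
    have q1 : ∀ l, S.D (W0 i l) * X l j ∈ S.E := fun l => S.OO _ (hCO i l) _ (hXO _ _)
    have q2 : ∀ l, (W0 i l : R) * S.D (X l j) ∈ S.E :=
      fun l => mul_mem (W0 i l).2 (S.DO _ (hXO _ _))
    rw [d1, S.D_sumE _ _ (fun l => add_mem (q1 l) (q2 l)), ← Finset.sum_add_distrib]
    refine Finset.sum_congr rfl fun l _ => ?_
    rw [S.addE _ (q1 l) _ (q2 l), S.D_OO _ (S.DE _ (W0 i l).2) _ (hXO _ _),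
      S.D_EE _ (W0 i l).2 _ (S.DO _ (hXO _ _))]
    abel
  -- ∂X
  have dX : ∀ i j, ∑ l, (W0 i l : R) * S.D (S.D (X l j)) =
      if i = Fin.last n then N (Fin.last n) j else 0 := by
    intro i j
    induction i using Fin.lastCases with
    | last =>
      rw [if_pos rfl, hNl, ← l1, d2]
      simp_rw [l0]
      abel
    | cast i =>
      rw [if_neg (Fin.castSucc_lt_last i).ne]
      have := d2 i.castSucc j
      rw [r1, hWXe] at this
      simp_rw [r0] at this
      simpa using this
  have dX' : ∀ i j, S.D (S.D (X i j)) = (W0i i (Fin.last n) : R) * N (Fin.last n) j := by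
    intro i j
    have e : S.im W0 * (Matrix.of fun i j => S.D (S.D (X i j))) =
        Matrix.of fun i j => if i = Fin.last n then N (Fin.last n) j else 0 := by
      ext i j
      rw [Matrix.mul_apply]
      exact dX i j
    have e2 := congrArg (fun M => (S.im W0i * M) i j) e
    simp only [← mul_assoc, ← map_mul] at e2
    rw [hW', map_one, one_mul, Matrix.mul_apply] at e2
    simpa using e2
  -- S2
  have hS2 : S.im (W0 * T) = S.im A - C * X := by
    ext i j
    rw [map_mul, Matrix.mul_apply, Matrix.sub_apply, Matrix.mul_apply]
    show ∑ l, (W0 i l : R) * S.D (X l j) = (A i j : R) - ∑ l, S.D (W0 i l) * X l j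
    rw [hA, d1, Finset.sum_add_distrib]
    abel
  -- Berezinian
  obtain ⟨P, hP⟩ := S.exists_lift _ (S.OO_mat hXO (S.EO_mat Ai hCO))
  obtain ⟨Q, hQ⟩ := S.exists_lift _ (S.OO_mat (S.EO_mat Ai hCO) hXO)
  have ber := S.ber _ _ hXO (S.EO_mat Ai hCO) P Q hP hQ
  have f1 : S1 = W0 * (1 - P) := by
    apply S.im_inj
    rw [hS1, map_mul, map_sub, map_one, hP, mul_sub, mul_one, ← mul_assoc, hWX, mul_assoc]
  have f2 : W0 * T = A * (1 - Q) := by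
    apply S.im_inj
    rw [hS2, map_mul S.im A, map_sub, map_one, hQ, mul_sub, mul_one, mul_assoc (S.im Ai), ← mul_assoc (S.im A),
      ← map_mul, hAi, map_one, one_mul]
  have g2 : T = W0i * (A * (1 - Q)) := by
    rw [← f2, ← mul_assoc, hW', one_mul]
  have dW : W0.det * W0i.det = 1 := by rw [← Matrix.det_mul, hW, Matrix.det_one]
  have dA : A.det * Ai.det = 1 := by rw [← Matrix.det_mul, hAi, Matrix.det_one]
  refine ⟨T.det, ?_, ?_⟩
  · rw [g2, f1]
    simp only [Matrix.det_mul]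
    calc _ = (W0.det * W0i.det) * (A.det * Ai.det) * ((1 - P).det * (1 - Q).det) := by ring
      _ = 1 := by rw [dW, dA, ber]; ring
  · have hNS : ∀ i j, i ≠ Fin.last n → N i j = ((W0 * T) i j : S.E) := by
      intro i j hi
      induction i using Fin.lastCases with
      | last => exact absurd rfl hi
      | cast i =>
        rw [hN]
        have := congrFun (congrFun hS2 i.castSucc) j
        rw [Matrix.sub_apply, Matrix.mul_apply] at this
        rw [show (((W0 * T) i.castSucc j : S.E) : R) = S.im (W0 * T) i.castSucc j from rfl, this,
          ← hA]
        rfl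
    rw [S.detR_last _ _ hNS, S.D_det]
    have hadj : ∀ j, (W0 * T).adjugate j (Fin.last n) * W0i.det =
        ∑ i, T.adjugate j i * W0i i (Fin.last n) := by
      intro j
      rw [Matrix.adjugate_mul_distrib]
      have : W0.adjugate = W0.det • W0i := by
        calc W0.adjugate = W0.adjugate * (W0 * W0i) := by rw [hW, mul_one]
          _ = _ := by rw [← mul_assoc, Matrix.adjugate_mul, Matrix.smul_mul, one_mul]
      rw [this, Matrix.mul_smul, Matrix.smul_apply, Matrix.mul_apply, smul_eq_mul, mul_right_comm,
        dW, one_mul]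
    rw [Finset.sum_mul, Finset.sum_comm]
    refine Finset.sum_congr rfl fun j _ => ?_
    rw [mul_assoc, ← S.comm _ (W0i.det).2, ← mul_assoc, ← Subring.coe_mul, hadj,
      ← Subring.subtype_apply, map_sum, Finset.sum_mul]
    refine Finset.sum_congr rfl fun i _ => ?_
    rw [hT, dX', ← mul_assoc]
    rfl
end SD

section LamAlg
variable {N : ℕ}

abbrev sg {N : ℕ} : SuperAlg N →ₐ[ℝ] SuperAlg N :=
  CliffordAlgebra.involute (Q := (0 : QuadraticForm ℝ (Fin N → ℝ)))

lemma sg_even {a : SuperAlg N} (h : a ∈ LambdaEven N) : sg a = a :=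
  CliffordAlgebra.involute_eq_of_mem_even h

lemma sg_odd {a : SuperAlg N} (h : a ∈ LambdaOdd N) : sg a = -a :=
  CliffordAlgebra.involute_eq_of_mem_odd h

lemma sg_sg (a : SuperAlg N) : sg (sg a) = a := CliffordAlgebra.involute_involute a

lemma two_tors {a : SuperAlg N} (h : a = -a) : a = 0 := by
  have h2 : (2 : ℝ) • a = 0 := by
    rw [two_smul]
    nth_rewrite 1 [h]
    exact neg_add_cancel a
  exact (smul_eq_zero.mp h2).resolve_left two_ne_zero

lemma lam_split (a : SuperAlg N) : ∃ e ∈ LambdaEven N, ∃ o ∈ LambdaOdd N, e + o = a := by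
  have h := (CliffordAlgebra.evenOdd_isCompl (0 : QuadraticForm ℝ (Fin N → ℝ))).sup_eq_top
  have : a ∈ LambdaEven N ⊔ LambdaOdd N := by
    rw [LambdaEven, LambdaOdd, h]; trivial
  obtain ⟨e, he, o, ho, rfl⟩ := Submodule.mem_sup.mp this
  exact ⟨e, he, o, ho, rfl⟩

lemma even_iff (a : SuperAlg N) : a ∈ LambdaEven N ↔ sg a = a := by
  refine ⟨sg_even, fun h => ?_⟩
  obtain ⟨e, he, o, ho, rfl⟩ := lam_split a
  rw [map_add, sg_even he, sg_odd ho] at h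
  have : o = 0 := two_tors (add_left_cancel h).symm
  simpa [this] using he

lemma odd_iff (a : SuperAlg N) : a ∈ LambdaOdd N ↔ sg a = -a := by
  refine ⟨sg_odd, fun h => ?_⟩
  obtain ⟨e, he, o, ho, rfl⟩ := lam_split a
  rw [map_add, sg_even he, sg_odd ho, neg_add] at h
  have : e = 0 := two_tors (add_right_cancel h)
  simpa [this] using ho

lemma iota_mul (v : Fin N → ℝ) (a : SuperAlg N) :
    ExteriorAlgebra.ι ℝ v * a = sg a * ExteriorAlgebra.ι ℝ v := by
  induction a using ExteriorAlgebra.induction with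
  | algebraMap r => rw [AlgHom.commutes, Algebra.commutes]
  | ι w =>
    have h1 : sg (ExteriorAlgebra.ι ℝ w) = -ExteriorAlgebra.ι ℝ w :=
      CliffordAlgebra.involute_ι w
    rw [h1, neg_mul]
    exact eq_neg_of_add_eq_zero_left (ExteriorAlgebra.ι_add_mul_swap v w)
  | mul a b ha hb => rw [map_mul, ← mul_assoc, ha, mul_assoc, hb, mul_assoc]
  | add a b ha hb => rw [map_add, mul_add, add_mul, ha, hb]

lemma even_comm {a : SuperAlg N} (h : a ∈ LambdaEven N) (g : SuperAlg N) : a * g = g * a := by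
  induction g using ExteriorAlgebra.induction with
  | algebraMap r => rw [Algebra.commutes]
  | ι w => rw [iota_mul, sg_even h]
  | mul b c hb hc => rw [← mul_assoc, hb, mul_assoc, hc, mul_assoc]
  | add b c hb hc => rw [mul_add, add_mul, hb, hc]

lemma odd_comm {a : SuperAlg N} (h : a ∈ LambdaOdd N) (g : SuperAlg N) : a * g = sg g * a := by
  induction g using ExteriorAlgebra.induction with
  | algebraMap r => rw [AlgHom.commutes, Algebra.commutes]
  | ι w =>
    have h1 : sg (ExteriorAlgebra.ι ℝ w) = -ExteriorAlgebra.ι ℝ w :=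
      CliffordAlgebra.involute_ι w
    rw [h1, neg_mul, iota_mul, sg_odd h, neg_mul, neg_neg]
  | mul b c hb hc => rw [map_mul, ← mul_assoc, hb, mul_assoc, hc, mul_assoc]
  | add b c hb hc => rw [map_add, mul_add, add_mul, hb, hc]

lemma sg_inverse (a : SuperAlg N) (h : IsUnit a) : sg (Ring.inverse a) = Ring.inverse (sg a) := by
  obtain ⟨u, rfl⟩ := h
  have : sg (u : SuperAlg N) = (Units.map (sg (N := N) : SuperAlg N →* SuperAlg N) u : SuperAlg N) := rfl
  rw [this, Ring.inverse_unit, Ring.inverse_unit]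
  rfl

end LamAlg

section Der
variable {N : ℕ}

/-- weak derivative -/
def HasDer (g : ℝ → SuperAlg N) (d : SuperAlg N) (x : ℝ) : Prop :=
  ∀ l : SuperAlg N →ₗ[ℝ] ℝ, HasDerivAt (fun y => l (g y)) (l d) x

lemma HasDer.unique {g : ℝ → SuperAlg N} {d d' : SuperAlg N} {x : ℝ} (h : HasDer g d x)
    (h' : HasDer g d' x) : d = d' := by
  rw [← sub_eq_zero, ← Module.forall_dual_apply_eq_zero_iff ℝ]
  intro l
  rw [map_sub, (h l).unique (h' l), sub_self]

lemma HasDer.derLam {g : ℝ → SuperAlg N} {d : SuperAlg N} {x : ℝ} (h : HasDer g d x) :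
    derLam g x = d := by
  have hh : ∃ d : SuperAlg N, ∀ l : SuperAlg N →ₗ[ℝ] ℝ,
      HasDerivAt (fun y => l (g y)) (l d) x := ⟨d, h⟩
  unfold _root_.derLam
  rw [dif_pos hh]
  exact HasDer.unique hh.choose_spec h

/-- the standard finite basis of the exterior algebra -/
def lamBasis (N : ℕ) : Module.Basis (Finset (Fin N)) ℝ (SuperAlg N) :=
  (Pi.basisFun ℝ (Fin N)).ExteriorAlgebra

lemma exp_lin (l : SuperAlg N →ₗ[ℝ] ℝ) (a : SuperAlg N) :
    l a = ∑ i, (lamBasis N).coord i a * l (lamBasis N i) := by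
  conv_lhs => rw [← (lamBasis N).sum_repr a]
  rw [map_sum]
  simp only [map_smul, smul_eq_mul, Module.Basis.coord_apply]

lemma exp_mul (l : SuperAlg N →ₗ[ℝ] ℝ) (a b : SuperAlg N) :
    l (a * b) = ∑ i, ∑ j, (lamBasis N).coord i a * (lamBasis N).coord j b *
      l (lamBasis N i * lamBasis N j) := by
  conv_lhs => rw [← (lamBasis N).sum_repr a, ← (lamBasis N).sum_repr b]
  rw [Finset.sum_mul, map_sum]
  refine Finset.sum_congr rfl fun i _ => ?_
  rw [Finset.mul_sum, map_sum]
  refine Finset.sum_congr rfl fun j _ => ?_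
  rw [smul_mul_smul_comm, map_smul, smul_eq_mul]
  rfl

lemma HasDer.add {g h : ℝ → SuperAlg N} {a b : SuperAlg N} {x : ℝ} (hg : HasDer g a x)
    (hh : HasDer h b x) : HasDer (fun y => g y + h y) (a + b) x := by
  intro l
  have := (hg l).fun_add (hh l)
  simp only [map_add]
  exact this

lemma HasDer.map {g : ℝ → SuperAlg N} {a : SuperAlg N} {x : ℝ} (hg : HasDer g a x)
    (P : SuperAlg N →ₗ[ℝ] SuperAlg N) : HasDer (fun y => P (g y)) (P a) x :=
  fun l => hg (l ∘ₗ P)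

lemma HasDer.mul {g h : ℝ → SuperAlg N} {a b : SuperAlg N} {x : ℝ} (hg : HasDer g a x)
    (hh : HasDer h b x) : HasDer (fun y => g y * h y) (a * h x + g x * b) x := by
  intro l
  have : HasDerivAt (fun y => ∑ i, ∑ j, (lamBasis N).coord i (g y) * (lamBasis N).coord j (h y) *
      l (lamBasis N i * lamBasis N j)) (∑ i, ∑ j, ((lamBasis N).coord i a * (lamBasis N).coord j (h x)
        + (lamBasis N).coord i (g x) * (lamBasis N).coord j b) *
      l (lamBasis N i * lamBasis N j)) x := by
    refine HasDerivAt.fun_sum fun i _ => HasDerivAt.fun_sum fun j _ => ?_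
    exact ((hg _).mul (hh _)).mul_const _
  convert this using 1
  · funext y; rw [exp_mul]
  · rw [map_add, exp_mul, exp_mul, ← Finset.sum_add_distrib]
    refine Finset.sum_congr rfl fun i _ => ?_
    rw [← Finset.sum_add_distrib]
    refine Finset.sum_congr rfl fun j _ => ?_
    ring

lemma SmoothLam.hasDer {g : ℝ → ℝ → SuperAlg N} (hg : SmoothLam g) (x t : ℝ) :
    HasDer (fun y => g y t) (∑ i, (fderiv ℝ (fun p : ℝ × ℝ => (lamBasis N).coord i (g p.1 p.2)) (x, t) (1, 0)) •
      lamBasis N i) x := by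
  intro l
  have : HasDerivAt (fun y => ∑ i, (lamBasis N).coord i (g y t) * l (lamBasis N i))
     (∑ i, (fderiv ℝ (fun p : ℝ × ℝ => (lamBasis N).coord i (g p.1 p.2)) (x, t) (1, 0)) *
      l (lamBasis N i)) x := by
    refine HasDerivAt.fun_sum fun i _ => HasDerivAt.mul_const ?_ _
    have h1 : HasFDerivAt (fun p : ℝ × ℝ => (lamBasis N).coord i (g p.1 p.2)) _ (x, t) :=
      (((hg ((lamBasis N).coord i)).differentiable (by simp)) (x, t)).hasFDerivAt
    have h2 : HasDerivAt (fun y : ℝ => (y, t)) ((1 : ℝ), (0 : ℝ)) x :=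
      (hasDerivAt_id x).prodMk (hasDerivAt_const x t)
    exact h1.comp_hasDerivAt x h2
  convert this using 1
  · funext y; rw [exp_lin]
  · simp

lemma SmoothLam.hasDer' {g : ℝ → ℝ → SuperAlg N} (hg : SmoothLam g) (x t : ℝ) :
    HasDer (fun y => g y t) (derLam (fun y => g y t) x) x := by
  rw [(hg.hasDer x t).derLam]; exact hg.hasDer x t

lemma SmoothLam.of_coord {g : ℝ → ℝ → SuperAlg N}
    (h : ∀ i, ContDiff ℝ (⊤ : ℕ∞) (fun p : ℝ × ℝ => (lamBasis N).coord i (g p.1 p.2))) :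
    SmoothLam g := by
  intro l
  rw [funext fun p : ℝ × ℝ => exp_lin l (g p.1 p.2)]
  exact ContDiff.sum fun i _ => (h i).mul contDiff_const

lemma SmoothLam.derLam {g : ℝ → ℝ → SuperAlg N} (hg : SmoothLam g) :
    SmoothLam (fun x t => derLam (fun y => g y t) x) := by
  intro l
  simp_rw [fun p : ℝ × ℝ => (hg.hasDer p.1 p.2).derLam]
  simp only [map_sum, map_smul, smul_eq_mul]
  refine ContDiff.sum fun i _ => ContDiff.mul ?_ contDiff_const
  exact ((hg ((lamBasis N).coord i)).fderiv_right (m := (⊤ : ℕ∞)) (by simp)).clm_apply contDiff_const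

lemma SmoothLam.add {g h : ℝ → ℝ → SuperAlg N} (hg : SmoothLam g) (hh : SmoothLam h) :
    SmoothLam (fun x t => g x t + h x t) := by
  intro l
  simpa using (hg l).add (hh l)

lemma SmoothLam.map {g : ℝ → ℝ → SuperAlg N} (hg : SmoothLam g) (P : SuperAlg N →ₗ[ℝ] SuperAlg N) :
    SmoothLam (fun x t => P (g x t)) := fun l => hg (l ∘ₗ P)

lemma SmoothLam.neg {g : ℝ → ℝ → SuperAlg N} (hg : SmoothLam g) :
    SmoothLam (fun x t => - g x t) := hg.map (-LinearMap.id)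

lemma SmoothLam.mul {g h : ℝ → ℝ → SuperAlg N} (hg : SmoothLam g) (hh : SmoothLam h) :
    SmoothLam (fun x t => g x t * h x t) := by
  intro l
  rw [funext fun p : ℝ × ℝ => exp_mul l (g p.1 p.2) (h p.1 p.2)]
  exact ContDiff.sum fun i _ => ContDiff.sum fun j _ => ((hg _).mul (hh _)).mul contDiff_const

lemma SmoothLam.const (a : SuperAlg N) : SmoothLam (fun _ _ => a) := fun _ => contDiff_const

lemma contDiff_det {m : Type} [Fintype m] [DecidableEq m] (M : ℝ × ℝ → Matrix m m ℝ)
    (h : ∀ i j, ContDiff ℝ (⊤ : ℕ∞) (fun p => M p i j)) :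
    ContDiff ℝ (⊤ : ℕ∞) (fun p => (M p).det) := by
  simp_rw [Matrix.det_apply']
  exact ContDiff.sum fun σ _ => contDiff_const.mul (contDiff_prod fun i _ => h _ _)

lemma SmoothLam.inverse {g : ℝ → ℝ → SuperAlg N} (hg : SmoothLam g) (hu : ∀ x t, IsUnit (g x t)) :
    SmoothLam (fun x t => Ring.inverse (g x t)) := by
  apply SmoothLam.of_coord
  intro i
  let M : ℝ × ℝ → Matrix (Finset (Fin N)) (Finset (Fin N)) ℝ :=
    fun p => Algebra.leftMulMatrix (lamBasis N) (g p.1 p.2)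
  have hM : ∀ i j, ContDiff ℝ (⊤ : ℕ∞) (fun p => M p i j) := by
    intro i j
    have : (fun p => M p i j) = fun p : ℝ × ℝ => (lamBasis N).coord i (g p.1 p.2 * lamBasis N j) := by
      funext p
      simp [M, Algebra.leftMulMatrix_eq_repr_mul]
    rw [this]
    exact (hg.mul (SmoothLam.const (lamBasis N j))) ((lamBasis N).coord i)
  have hMu : ∀ p, IsUnit (M p).det := fun p =>
    (Matrix.isUnit_iff_isUnit_det _).mp ((hu p.1 p.2).map (Algebra.leftMulMatrix (lamBasis N)))
  have hdet := contDiff_det M hM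
  have hadj : ∀ i j, ContDiff ℝ (⊤ : ℕ∞) (fun p => (M p).adjugate i j) := by
    intro i j
    simp_rw [Matrix.adjugate_apply]
    refine contDiff_det _ fun a b => ?_
    by_cases h : a = j
    · subst h; simp only [Matrix.updateRow_self]; exact contDiff_const
    · simp only [Matrix.updateRow_ne h]; exact hM a b
  have key : ∀ p : ℝ × ℝ, (lamBasis N).coord i (Ring.inverse (g p.1 p.2)) =
      ∑ j, ((M p).det)⁻¹ * (M p).adjugate i j * (lamBasis N).coord j 1 := by
    intro p
    have h1 : g p.1 p.2 * Ring.inverse (g p.1 p.2) = 1 := Ring.mul_inverse_cancel _ (hu _ _)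
    have h2 : (M p).mulVec ((lamBasis N).repr (Ring.inverse (g p.1 p.2))) = (lamBasis N).repr 1 := by
      rw [Algebra.leftMulMatrix_mulVec_repr, h1]
    have h3 : (M p).adjugate.mulVec ((lamBasis N).repr 1) =
        (M p).det • ⇑((lamBasis N).repr (Ring.inverse (g p.1 p.2))) := by
      rw [← h2, Matrix.mulVec_mulVec, Matrix.adjugate_mul, Matrix.smul_mulVec, Matrix.one_mulVec]
    have h4 := congrFun h3 i
    simp only [Matrix.mulVec, dotProduct, Pi.smul_apply, smul_eq_mul] at h4
    simp_rw [mul_assoc, ← Finset.mul_sum]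
    simp only [Module.Basis.coord_apply]
    rw [h4, inv_mul_cancel_left₀ (hMu p).ne_zero]
  simp_rw [key]
  exact ContDiff.sum fun j _ =>
    ((hdet.inv fun p => (hMu p).ne_zero).mul (hadj i j)).mul contDiff_const

end Der

section SFRing
variable {N : ℕ}

lemma sf_ext {f g : SF N} (h0 : ∀ x t, f.c0 x t = g.c0 x t) (h1 : ∀ x t, f.c1 x t = g.c1 x t) :
    f = g := SF.ext (funext fun x => funext fun t => h0 x t) (funext fun x => funext fun t => h1 x t)

lemma sf_add0 (f g : SF N) (x t) : (f + g).c0 x t = f.c0 x t + g.c0 x t := rfl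
lemma sf_add1 (f g : SF N) (x t) : (f + g).c1 x t = f.c1 x t + g.c1 x t := rfl
lemma sf_sub0 (f g : SF N) (x t) : (f - g).c0 x t = f.c0 x t - g.c0 x t := rfl
lemma sf_sub1 (f g : SF N) (x t) : (f - g).c1 x t = f.c1 x t - g.c1 x t := rfl
lemma sf_neg0 (f : SF N) (x t) : (-f).c0 x t = -f.c0 x t := rfl
lemma sf_neg1 (f : SF N) (x t) : (-f).c1 x t = -f.c1 x t := rfl
lemma sf_zero0 (x t) : (0 : SF N).c0 x t = 0 := rfl
lemma sf_zero1 (x t) : (0 : SF N).c1 x t = 0 := rfl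
lemma sf_one0 (x t) : (1 : SF N).c0 x t = 1 := rfl
lemma sf_one1 (x t) : (1 : SF N).c1 x t = 0 := rfl
lemma sf_mul0 (f g : SF N) (x t) : (f * g).c0 x t = f.c0 x t * g.c0 x t := rfl
lemma sf_mul1 (f g : SF N) (x t) : (f * g).c1 x t = f.c1 x t * g.c0 x t + sg (f.c0 x t) * g.c1 x t := rfl
lemma sf_D0 (f : SF N) (x t) : f.Dsd.c0 x t = f.c1 x t := rfl
lemma sf_D1 (f : SF N) (x t) : f.Dsd.c1 x t = derLam (fun y => f.c0 y t) x := rfl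

/-- the ring of superfields -/
abbrev sfRing (N : ℕ) : Ring (SF N) :=
  { (inferInstance : AddCommGroup (SF N)) with
    mul := (· * ·)
    one := 1
    mul_assoc := fun a b c => sf_ext (fun x t => by simp only [sf_mul0, mul_assoc])
      (fun x t => by simp only [sf_mul0, sf_mul1, mul_assoc, map_mul, add_mul, mul_add, add_assoc])
    one_mul := fun a => sf_ext (fun x t => by simp only [sf_mul0, sf_one0, one_mul])
      (fun x t => by simp only [sf_mul1, sf_one0, sf_one1, one_mul, zero_mul, map_one, zero_add])
    mul_one := fun a => sf_ext (fun x t => by simp only [sf_mul0, sf_one0, mul_one])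
      (fun x t => by simp only [sf_mul1, sf_one0, sf_one1, mul_one, mul_zero, add_zero])
    zero_mul := fun a => sf_ext (fun x t => by simp only [sf_mul0, sf_zero0, zero_mul])
      (fun x t => by simp only [sf_mul1, sf_zero0, sf_zero1, zero_mul, map_zero, add_zero])
    mul_zero := fun a => sf_ext (fun x t => by simp only [sf_mul0, sf_zero0, mul_zero])
      (fun x t => by simp only [sf_mul1, sf_zero0, sf_zero1, mul_zero, add_zero])
    left_distrib := fun a b c => sf_ext (fun x t => by simp only [sf_mul0, sf_add0, mul_add])
      (fun x t => by simp only [sf_mul1, sf_add0, sf_add1, mul_add]; abel)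
    right_distrib := fun a b c => sf_ext (fun x t => by simp only [sf_mul0, sf_add0, add_mul])
      (fun x t => by simp only [sf_mul1, sf_add0, sf_add1, add_mul, map_add]; abel) }

/-- even smooth -/
structure ES (f : SF N) : Prop where
  e0 : ∀ x t, f.c0 x t ∈ LambdaEven N
  e1 : ∀ x t, f.c1 x t ∈ LambdaOdd N
  s0 : SmoothLam f.c0
  s1 : SmoothLam f.c1

/-- odd smooth -/
structure OS (f : SF N) : Prop where
  e0 : ∀ x t, f.c0 x t ∈ LambdaOdd N
  e1 : ∀ x t, f.c1 x t ∈ LambdaEven N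
  s0 : SmoothLam f.c0
  s1 : SmoothLam f.c1

lemma ee {a b : SuperAlg N} (ha : a ∈ LambdaEven N) (hb : b ∈ LambdaEven N) :
    a * b ∈ LambdaEven N := by
  rw [even_iff, map_mul, sg_even ha, sg_even hb]
lemma eo {a b : SuperAlg N} (ha : a ∈ LambdaEven N) (hb : b ∈ LambdaOdd N) :
    a * b ∈ LambdaOdd N := by
  rw [odd_iff, map_mul, sg_even ha, sg_odd hb, mul_neg]
lemma oe {a b : SuperAlg N} (ha : a ∈ LambdaOdd N) (hb : b ∈ LambdaEven N) :
    a * b ∈ LambdaOdd N := by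
  rw [odd_iff, map_mul, sg_odd ha, sg_even hb, neg_mul]
lemma oo {a b : SuperAlg N} (ha : a ∈ LambdaOdd N) (hb : b ∈ LambdaOdd N) :
    a * b ∈ LambdaEven N := by
  rw [even_iff, map_mul, sg_odd ha, sg_odd hb, neg_mul_neg]
lemma sge {a : SuperAlg N} (ha : a ∈ LambdaEven N) : sg a ∈ LambdaEven N := by
  rwa [sg_even ha]
lemma sgo {a : SuperAlg N} (ha : a ∈ LambdaOdd N) : sg a ∈ LambdaOdd N := by
  rw [sg_odd ha]; exact neg_mem ha
lemma one_even : (1 : SuperAlg N) ∈ LambdaEven N := by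
  rw [even_iff, map_one]

lemma der_even {g : ℝ → ℝ → SuperAlg N} (hg : SmoothLam g) (h : ∀ x t, g x t ∈ LambdaEven N) (x t) :
    derLam (fun y => g y t) x ∈ LambdaEven N := by
  rw [even_iff]
  have h1 := hg.hasDer' x t
  have h2 := h1.map sg.toLinearMap
  have h3 : (fun y => sg.toLinearMap (g y t)) = fun y => g y t := funext fun y => sg_even (h y t)
  rw [h3] at h2
  exact h2.unique h1

lemma der_odd {g : ℝ → ℝ → SuperAlg N} (hg : SmoothLam g) (h : ∀ x t, g x t ∈ LambdaOdd N) (x t) :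
    derLam (fun y => g y t) x ∈ LambdaOdd N := by
  rw [odd_iff]
  have h1 := hg.hasDer' x t
  have h2 := h1.map (-sg.toLinearMap)
  have h3 : (fun y => (-sg.toLinearMap) (g y t)) = fun y => g y t := funext fun y => by
    show - sg (g y t) = _
    rw [sg_odd (h y t), neg_neg]
  rw [h3] at h2
  have := h2.unique h1
  exact neg_eq_iff_eq_neg.mp this

lemma der_add {g h : ℝ → ℝ → SuperAlg N} (hg : SmoothLam g) (hh : SmoothLam h) (x t) :
    derLam (fun y => g y t + h y t) x = derLam (fun y => g y t) x + derLam (fun y => h y t) x :=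
  ((hg.hasDer' x t).add (hh.hasDer' x t)).derLam

lemma der_mul {g h : ℝ → ℝ → SuperAlg N} (hg : SmoothLam g) (hh : SmoothLam h) (x t) :
    derLam (fun y => g y t * h y t) x =
      derLam (fun y => g y t) x * h x t + g x t * derLam (fun y => h y t) x :=
  ((hg.hasDer' x t).mul (hh.hasDer' x t)).derLam

lemma sm_mul0 {f g : SF N} (f0 : SmoothLam f.c0) (g0 : SmoothLam g.c0) : SmoothLam (f * g).c0 :=
  f0.mul g0
lemma sm_mul1 {f g : SF N} (f0 : SmoothLam f.c0) (f1 : SmoothLam f.c1) (g0 : SmoothLam g.c0)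
    (g1 : SmoothLam g.c1) : SmoothLam (f * g).c1 :=
  (f1.mul g0).add ((f0.map sg.toLinearMap).mul g1)

lemma sf_dmul {f g : SF N} (f0 : SmoothLam f.c0) (g0 : SmoothLam g.c0) (x t) :
    derLam (fun y => (f * g).c0 y t) x =
      derLam (fun y => f.c0 y t) x * g.c0 x t + f.c0 x t * derLam (fun y => g.c0 y t) x :=
  der_mul f0 g0 x t

attribute [local instance] sfRing

/-- the super-differential structure on superfields -/
def sfSD (N : ℕ) : SD (SF N) where
  E := { carrier := {f | ES f}
         mul_mem' := fun {a b} ha hb => ⟨fun x t => ee (ha.e0 x t) (hb.e0 x t),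
           fun x t => add_mem (oe (ha.e1 x t) (hb.e0 x t)) (eo (sge (ha.e0 x t)) (hb.e1 x t)),
           sm_mul0 ha.s0 hb.s0, sm_mul1 ha.s0 ha.s1 hb.s0 hb.s1⟩
         one_mem' := ⟨fun x t => one_even, fun x t => zero_mem _, SmoothLam.const 1, SmoothLam.const 0⟩
         add_mem' := fun {a b} ha hb => ⟨fun x t => add_mem (ha.e0 x t) (hb.e0 x t),
           fun x t => add_mem (ha.e1 x t) (hb.e1 x t), ha.s0.add hb.s0, ha.s1.add hb.s1⟩
         zero_mem' := ⟨fun x t => zero_mem _, fun x t => zero_mem _, SmoothLam.const 0, SmoothLam.const 0⟩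
         neg_mem' := fun {a} ha => ⟨fun x t => neg_mem (ha.e0 x t),
           fun x t => neg_mem (ha.e1 x t), ha.s0.neg, ha.s1.neg⟩ }
  O := { carrier := {f | OS f}
         add_mem' := fun {a b} ha hb => ⟨fun x t => add_mem (ha.e0 x t) (hb.e0 x t),
           fun x t => add_mem (ha.e1 x t) (hb.e1 x t), ha.s0.add hb.s0, ha.s1.add hb.s1⟩
         zero_mem' := ⟨fun x t => zero_mem _, fun x t => zero_mem _, SmoothLam.const 0, SmoothLam.const 0⟩
         neg_mem' := fun {a} ha => ⟨fun x t => neg_mem (ha.e0 x t),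
           fun x t => neg_mem (ha.e1 x t), ha.s0.neg, ha.s1.neg⟩ }
  D := SF.Dsd
  comm := fun e he r => sf_ext (fun x t => by rw [sf_mul0, sf_mul0, even_comm (he.e0 x t)])
    (fun x t => by rw [sf_mul1, sf_mul1, sg_even (he.e0 x t), even_comm (he.e0 x t),
      odd_comm (he.e1 x t), add_comm])
  EO := fun a ha b hb => ⟨fun x t => eo (ha.e0 x t) (hb.e0 x t),
    fun x t => add_mem (oo (ha.e1 x t) (hb.e0 x t)) (ee (sge (ha.e0 x t)) (hb.e1 x t)),
    sm_mul0 ha.s0 hb.s0, sm_mul1 ha.s0 ha.s1 hb.s0 hb.s1⟩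
  OO := fun a ha b hb => ⟨fun x t => oo (ha.e0 x t) (hb.e0 x t),
    fun x t => add_mem (eo (ha.e1 x t) (hb.e0 x t)) (oe (sgo (ha.e0 x t)) (hb.e1 x t)),
    sm_mul0 ha.s0 hb.s0, sm_mul1 ha.s0 ha.s1 hb.s0 hb.s1⟩
  anti := fun a ha b hb => sf_ext
    (fun x t => by rw [sf_neg0, sf_mul0, sf_mul0, odd_comm (ha.e0 x t), sg_odd (hb.e0 x t), neg_mul])
    (fun x t => by
      rw [sf_neg1, sf_mul1, sf_mul1, sg_odd (ha.e0 x t), sg_odd (hb.e0 x t), even_comm (ha.e1 x t),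
        even_comm (hb.e1 x t)]
      simp only [neg_mul, neg_add, neg_neg]
      abel)
  sq := fun a ha => sf_ext
    (fun x t => two_tors (by
      rw [sf_mul0]
      conv_lhs => rw [odd_comm (ha.e0 x t), sg_odd (ha.e0 x t), neg_mul]))
    (fun x t => by
      rw [sf_mul1, sg_odd (ha.e0 x t), even_comm (ha.e1 x t), neg_mul, add_neg_cancel]; rfl)
  DE := fun e he => ⟨he.e1, der_even he.s0 he.e0, he.s1, he.s0.derLam⟩
  DO := fun e he => ⟨he.e1, der_odd he.s0 he.e0, he.s1, he.s0.derLam⟩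
  addE := fun a ha b hb => sf_ext (fun x t => rfl) (fun x t => der_add ha.s0 hb.s0 x t)
  addO := fun a ha b hb => sf_ext (fun x t => rfl) (fun x t => der_add ha.s0 hb.s0 x t)
  D_EE := fun a ha b hb => sf_ext
    (fun x t => by
      rw [sf_add0, sf_mul0, sf_mul0, sf_D0, sf_D0, sf_D0, sf_mul1, sg_even (ha.e0 x t)])
    (fun x t => by
      rw [sf_D1, sf_dmul ha.s0 hb.s0, sf_add1, sf_mul1, sf_mul1, sf_D0, sf_D0, sf_D1, sf_D1,
        sg_even (ha.e0 x t), sg_odd (ha.e1 x t), neg_mul]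
      abel)
  D_EO := fun a ha b hb => sf_ext
    (fun x t => by
      rw [sf_add0, sf_mul0, sf_mul0, sf_D0, sf_D0, sf_D0, sf_mul1, sg_even (ha.e0 x t)])
    (fun x t => by
      rw [sf_D1, sf_dmul ha.s0 hb.s0, sf_add1, sf_mul1, sf_mul1, sf_D0, sf_D0, sf_D1, sf_D1,
        sg_even (ha.e0 x t), sg_odd (ha.e1 x t), neg_mul]
      abel)
  D_OO := fun a ha b hb => sf_ext
    (fun x t => by
      rw [sf_sub0, sf_mul0, sf_mul0, sf_D0, sf_D0, sf_D0, sf_mul1, sg_odd (ha.e0 x t), neg_mul,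
        sub_eq_add_neg])
    (fun x t => by
      rw [sf_D1, sf_dmul ha.s0 hb.s0, sf_sub1, sf_mul1, sf_mul1, sf_D0, sf_D0, sf_D1, sf_D1,
        sg_odd (ha.e0 x t), sg_even (ha.e1 x t), neg_mul]
      abel)

lemma sinv_mem {f : SF N} (h : ES f) (hi : f.Invertible) : ES f.sinv := by
  have e0 : ∀ x t, Ring.inverse (f.c0 x t) ∈ LambdaEven N := fun x t => by
    rw [even_iff, sg_inverse _ (hi x t), sg_even (h.e0 x t)]
  have s0 := h.s0.inverse hi
  have hs : f.sinv.c1 = fun x t => -(Ring.inverse (f.c0 x t) * f.c1 x t * Ring.inverse (f.c0 x t)) := by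
    funext x t
    show -(Ring.inverse (sg (f.c0 x t)) * _ * _) = _
    rw [sg_even (h.e0 x t)]
  refine ⟨e0, ?_, s0, ?_⟩
  · rw [hs]; exact fun x t => neg_mem (oe (eo (e0 x t) (h.e1 x t)) (e0 x t))
  · rw [hs]; exact ((s0.mul h.s1).mul s0).neg

lemma mul_sinv {f : SF N} (hi : f.Invertible) : f * f.sinv = 1 := by
  refine sf_ext (fun x t => Ring.mul_inverse_cancel _ (hi x t)) fun x t => ?_
  have h2 : IsUnit (sg (f.c0 x t)) := (hi x t).map sg
  show f.c1 x t * Ring.inverse (f.c0 x t) + sg (f.c0 x t) *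
    -(Ring.inverse (sg (f.c0 x t)) * f.c1 x t * Ring.inverse (f.c0 x t)) = 0
  rw [mul_neg, mul_assoc, Ring.mul_inverse_cancel_left _ _ h2, add_neg_cancel]

lemma sinv_unique {f g : SF N} (h : f * g = 1) (h' : g * f = 1) : f.sinv = g := by
  have hi : f.Invertible := fun x t => by
    have a : f.c0 x t * g.c0 x t = 1 := congrFun (congrFun (congrArg SF.c0 h) x) t
    have b : g.c0 x t * f.c0 x t = 1 := congrFun (congrFun (congrArg SF.c0 h') x) t
    exact ⟨⟨_, _, a, b⟩, rfl⟩
  calc f.sinv = (g * f) * f.sinv := by rw [h', one_mul]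
    _ = g := by rw [mul_assoc, mul_sinv hi, mul_one]

lemma Xpow_es {f : SF N} (h : ES f) (m : ℕ) : ES (Xpow m f) := by
  induction m with
  | zero => exact h
  | succ m ih => exact (sfSD N).DO _ ((sfSD N).DE _ ih)

lemma Xpow_os {f : SF N} (h : OS f) (m : ℕ) : OS (Xpow m f) := by
  induction m with
  | zero => exact h
  | succ m ih => exact (sfSD N).DE _ ((sfSD N).DO _ ih)

lemma inv_lift {n : ℕ} (M : Matrix (Fin (n+1)) (Fin (n+1)) (sfSD N).E)
    (hi : (detSF ((sfSD N).im M)).Invertible) :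
    ∃ Mi : Matrix (Fin (n+1)) (Fin (n+1)) (sfSD N).E, M * Mi = 1 ∧
      invSF ((sfSD N).im M) = (sfSD N).im Mi ∧ (detSF ((sfSD N).im M)).sinv = (Mi.det : SF N) := by
  have hd : detSF ((sfSD N).im M) = (M.det : SF N) := (sfSD N).detR_im M
  have hE : ES (M.det : SF N) := M.det.2
  rw [hd] at hi
  let u : (sfSD N).E := ⟨(M.det : SF N).sinv, sinv_mem hE hi⟩
  have hu : M.det * u = 1 := Subtype.ext (mul_sinv hi)
  have hM : M * (u • M.adjugate) = 1 := by
    rw [Matrix.mul_smul, Matrix.mul_adjugate, smul_smul, mul_comm u, hu, one_smul]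
  refine ⟨u • M.adjugate, hM, ?_, ?_⟩
  · ext1 i j
    show (detSF ((sfSD N).im M)).sinv * ((-1 : ℤ) ^ (i.1 + j.1) • detSF (minorSF ((sfSD N).im M) j i)) =
      (M.det : SF N).sinv * ((M.adjugate i j : (sfSD N).E) : SF N)
    rw [hd, Matrix.adjugate_fin_succ_eq_det_submatrix]
    congr 1
    have hm : minorSF ((sfSD N).im M) j i = (sfSD N).im (M.submatrix j.succAbove i.succAbove) := by
      have : ∀ (j : Fin (n+1)) (a : Fin n), dropIdx j a = j.succAbove a := by
        intro j a
        apply Fin.ext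
        simp only [dropIdx, Fin.succAbove, Fin.lt_def]
        by_cases h : (a : ℕ) < j
        · have h' : (a.castSucc : ℕ) < j := h
          rw [if_pos h, if_pos h']; rfl
        · have h' : ¬ (a.castSucc : ℕ) < j := h
          rw [if_neg h, if_neg h']; rfl
      ext1 a b
      show ((M (dropIdx j a) (dropIdx i b) : (sfSD N).E) : SF N) = _
      rw [this, this]
      rfl
    have h2 : detSF (minorSF ((sfSD N).im M) j i) = ((M.submatrix j.succAbove i.succAbove).det : SF N) := by
      rw [hm]; exact (sfSD N).detR_im _
    rw [h2]
    rw [show (((-1 : (sfSD N).E) ^ (j.1 + i.1) * (M.submatrix j.succAbove i.succAbove).det : (sfSD N).E) : SF N)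
      = (((-1 : ℤ) ^ (i.1 + j.1) • (M.submatrix j.succAbove i.succAbove).det : (sfSD N).E) : SF N) by
        rw [zsmul_eq_mul, add_comm]; push_cast; rfl]
    rfl
  · rw [hd]
    have : M.det * (u • M.adjugate).det = 1 := by
      rw [← Matrix.det_mul, hM, Matrix.det_one]
    refine sinv_unique ?_ ?_
    · exact congrArg Subtype.val this
    · rw [mul_comm] at this; exact congrArg Subtype.val this

theorem final (n : ℕ) (θ : ℕ → SF N)
    (hθs : ∀ j < 2*(n+1), (θ j).Smooth) (hθp : ∀ j < 2*(n+1), parityAt (θ j) j)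
    (h0i : (detSF (W0E N (n+1) θ)).Invertible)
    (h1i : (detSF (DmatSF (W1E N (n+1) θ))).Invertible) :
    ((sdetE N (n+1) θ).sinv).Dsd
      = detSF (WmatBarD N (n+1) (oddSeq θ)
            - WmatBarD N (n+1) (evenSeq θ) * invSF (W0E N (n+1) θ) * W1E N (n+1) θ)
        * (detSF (W0E N (n+1) θ)).sinv := by
  have hev : ∀ j : Fin (n+1), ES (evenSeq θ j) := fun j => by
    have hj : 2 * j.1 < 2 * (n+1) := by omega
    have hp := hθp _ hj
    rw [parityAt, if_pos (by omega)] at hp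
    exact ⟨hp.1, hp.2, (hθs _ hj).1, (hθs _ hj).2⟩
  have hod : ∀ j : Fin (n+1), OS (oddSeq θ j) := fun j => by
    have hj : 2 * j.1 + 1 < 2 * (n+1) := by omega
    have hp := hθp _ hj
    rw [parityAt, if_neg (by omega)] at hp
    exact ⟨hp.1, hp.2, (hθs _ hj).1, (hθs _ hj).2⟩
  have hW1 : ∀ i j, W1E N (n+1) θ i j ∈ (sfSD N).O := fun i j => Xpow_os (hod j) i
  obtain ⟨W0, hW0⟩ := (sfSD N).exists_lift (W0E N (n+1) θ) (fun i j => Xpow_es (hev j) i)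
  obtain ⟨A, hA⟩ := (sfSD N).exists_lift (DmatSF (W1E N (n+1) θ))
    (fun i j => (sfSD N).DO _ (hW1 i j))
  have eW0 : ∀ i j, ((W0 i j : (sfSD N).E) : SF N) = Xpow i.1 (evenSeq θ j) := fun i j =>
    congrFun (congrFun hW0 i) j
  rw [← hW0] at h0i
  rw [← hA] at h1i
  obtain ⟨W0i, hWi, iW, dW⟩ := inv_lift W0 h0i
  obtain ⟨Ai, hAi, iA, dA⟩ := inv_lift A h1i
  have hDW : ∀ i j, DmatSF (W0E N (n+1) θ) i j ∈ (sfSD N).O := fun i j =>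
    (sfSD N).DE _ (Xpow_es (hev j) i)
  have hSm : ∀ i j, SchurE N (n+1) θ i j ∈ (sfSD N).E := by
    intro i j
    have h1 := (sfSD N).OO_mat ((sfSD N).OE_mat Ai hW1) hDW i j
    rw [← iA, hA] at h1
    exact sub_mem (Xpow_es (hev j) i) h1
  obtain ⟨S1, hS1⟩ := (sfSD N).exists_lift _ hSm
  obtain ⟨t, ht, hD⟩ := (sfSD N).main W0 W0i A Ai S1 (W1E N (n+1) θ)
    (fun j => Xpow (n+1) (evenSeq θ j)) (fun j => Xpow (n+1) (oddSeq θ j)) hW1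
    (fun i j => congrFun (congrFun hA i) j) hWi hAi
    (by
      rw [hS1, ← iA, hA, hW0]
      have : (Matrix.of fun i j => (sfSD N).D (W0 i j : SF N)) = DmatSF (W0E N (n+1) θ) := by
        ext1 i j
        show SF.Dsd (W0 i j : SF N) = SF.Dsd _
        rw [eW0]; rfl
      rw [this]; rfl)
    (fun i j => by rw [eW0, eW0]; rfl)
    (fun i j => rfl)
    (fun j => by rw [eW0]; rfl)
    (fun j => rfl)
    (WmatBarD N (n+1) (oddSeq θ)
            - WmatBarD N (n+1) (evenSeq θ) * (invSF (W0E N (n+1) θ) * W1E N (n+1) θ))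
    (fun i j => by
      have e : ∀ v : ℕ → SF N, ∀ l, WmatBarD N (n+1) v i.castSucc l = (Xpow i.1 (v l)).Dsd := by
        intro v l
        have hi := i.2
        show (if i.1 = n + 1 - 1 then _ else _) = _
        rw [if_neg (by omega)]; rfl
      rw [Matrix.sub_apply, Matrix.mul_apply, e, ← hW0, iW]
      congr 1
      refine Finset.sum_congr rfl fun l _ => ?_
      rw [e, eW0]; rfl)
    (fun j => by
      have e : ∀ v : ℕ → SF N, ∀ l, WmatBarD N (n+1) v (Fin.last n) l = Xpow (n+1) (v l) := by
        intro v l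
        show (if n = n + 1 - 1 then _ else _) = _
        rw [if_pos (by omega)]
      rw [Matrix.sub_apply, Matrix.mul_apply, e, ← hW0, iW]
      congr 1
      refine Finset.sum_congr rfl fun l _ => ?_
      rw [e])
  have hs : sdetE N (n+1) θ = ((S1.det * Ai.det : (sfSD N).E) : SF N) := by
    have h1 : detSF (SchurE N (n+1) θ) = (S1.det : SF N) := by
      rw [← hS1]; exact (sfSD N).detR_im _
    rw [sdetE, h1, ← hA, dA]; rfl
  have ht' : t * (S1.det * Ai.det) = 1 := by rw [mul_comm]; exact ht
  have hsi : (sdetE N (n+1) θ).sinv = (t : SF N) := by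
    rw [hs]
    exact sinv_unique (congrArg Subtype.val ht) (congrArg Subtype.val ht')
  have hassoc : WmatBarD N (n+1) (evenSeq θ) * invSF (W0E N (n+1) θ) * W1E N (n+1) θ =
    WmatBarD N (n+1) (evenSeq θ) * (invSF (W0E N (n+1) θ) * W1E N (n+1) θ) :=
    Matrix.mul_assoc _ _ _
  have dW' : (detSF (W0E N (n+1) θ)).sinv = (W0i.det : SF N) := by rw [← hW0]; exact dW
  rw [hsi, dW']
  refine Eq.trans hD ?_
  rw [← hassoc]
  rfl

end SFRing

/-- `D((sdet 𝒲)⁻¹) = det(DW̄^{(1)} − (DW̄^{(0)})(W^{(0)})⁻¹W^{(1)}) (det W^{(0)})⁻¹`. -/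
theorem statement_8 {N : ℕ} (hN : 1 ≤ N) (k : ℕ) (hk : 1 ≤ k) (θ : ℕ → SF N)
    (hθs : ∀ j < 2*k, (θ j).Smooth) (hθp : ∀ j < 2*k, parityAt (θ j) j)
    (h0e : (detSF (W0E N k θ)).IsEven)
    (h0i : (detSF (W0E N k θ)).Invertible)
    (h1e : (detSF (DmatSF (W1E N k θ))).IsEven)
    (h1i : (detSF (DmatSF (W1E N k θ))).Invertible)
    (h2e : (detSF (SchurE N k θ)).IsEven)
    (h2i : (detSF (SchurE N k θ)).Invertible)
    (h3e : (detSF (SchurE2 N k θ)).IsEven)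
    (h3i : (detSF (SchurE2 N k θ)).Invertible) :
    ((sdetE N k θ).sinv).Dsd
      = detSF (WmatBarD N k (oddSeq θ)
            - WmatBarD N k (evenSeq θ) * invSF (W0E N k θ) * W1E N k θ)
        * (detSF (W0E N k θ)).sinv := by
  obtain ⟨n, rfl⟩ : ∃ n, k = n + 1 := ⟨k - 1, by omega⟩
  exact final n θ hθs hθp h0i h1i
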